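/- Let k ≥ 2 and T'_k = (σ₁σ₃)^{2k−2}(σ₃σ₄Δ₃)(Δ₃σ₄)[(δ₃σ₄)(δ̃₃σ₄)]^{k−1}(δ₃σ₄σ₃σ₄) ∈ B₅. Then σ₁⁻¹ T'_k σ₁ = (σ₁σ₃)^{2k−2}(σ₃σ₄Δ₃)(δ̃₃σ₄)[(δ₃σ₄)(δ̃₃σ₄)]^{k−1}(δ₃σ₄σ₃σ₄)σ₁, and this conjugate x = σ₁⁻¹T'_kσ₁ satisfies: x is positive, ¬(Δ ≼ x), x ≼ Δ^{4k}, and ¬(x ≼ Δ^{4k−1}). In particular its canonical length is 4k, so σ₁⁻¹T'_kσ₁ does not belong to the super summit set of T'_k. -/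

import Mathlib

/-- Defining relations of the braid group on 5 strands, as elements of the
free group on four generators (generator `i` corresponds to `σ_{i+1}`). -/
def braidRels : Set (FreeGroup (Fin 4)) :=
  { r | (∃ i : Fin 3, r = FreeGroup.of i.castSucc * FreeGroup.of i.succ * FreeGroup.of i.castSucc *
          (FreeGroup.of i.succ * FreeGroup.of i.castSucc * FreeGroup.of i.succ)⁻¹) ∨
        (∃ i j : Fin 4, 2 ≤ |(i : ℤ) - (j : ℤ)| ∧
          r = FreeGroup.of i * FreeGroup.of j * (FreeGroup.of j * FreeGroup.of i)⁻¹) }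

/-- The Artin braid group on 5 strands. -/
abbrev B5 : Type := PresentedGroup braidRels

/-- The Artin generators (index `i` corresponds to `σ_{i+1}`). -/
def gen (i : Fin 4) : B5 := PresentedGroup.of i

def s1 : B5 := gen 0
def s2 : B5 := gen 1
def s3 : B5 := gen 2
def s4 : B5 := gen 3

/-- A braid is positive if it lies in the submonoid generated by `σ₁,…,σ₄`. -/
def IsPos (x : B5) : Prop := x ∈ Submonoid.closure (Set.range gen)

/-- Prefix order: `Pre x y` means `x ≼ y`, i.e. `x⁻¹ y` is positive. -/
def Pre (x y : B5) : Prop := IsPos (x⁻¹ * y)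

/-- The half twist `Δ = σ₁σ₂σ₃σ₄σ₁σ₂σ₃σ₁σ₂σ₁`. -/
def Δ : B5 := s1*s2*s3*s4*s1*s2*s3*s1*s2*s1

def δ3 : B5 := s2*s1
def Δ3 : B5 := s2*s1*s2
def δt3 : B5 := s1*s2

/-- A braid `s` is simple if `1 ≼ s ≼ Δ`. -/
def IsSimple (s : B5) : Prop := IsPos s ∧ Pre s Δ

/-- Two simple braids `s, t` are left-weighted if no generator `σᵢ` is such that
`s σᵢ` and `σᵢ⁻¹ t` are both simple. -/
def LeftWeighted (s t : B5) : Prop :=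
  ¬ ∃ i : Fin 4, IsSimple (s * gen i) ∧ IsSimple ((gen i)⁻¹ * t)

/-- The canonical length of `z`: the minimum of `q - p` over `p ≤ q` with
`Δ^p ≼ z` and `z ≼ Δ^q`. -/
noncomputable def canLen (z : B5) : ℕ :=
  sInf { n : ℕ | ∃ p q : ℤ, p ≤ q ∧ q - p = (n : ℤ) ∧ Pre (Δ ^ p) z ∧ Pre z (Δ ^ q) }

/-- `y` belongs to the super summit set of `x`:
`y` is conjugate to `x` and has minimal canonical length among conjugates of `x`. -/
def InSSS (x y : B5) : Prop :=
  IsConj x y ∧ ∀ z : B5, IsConj x z → canLen y ≤ canLen z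

/-- The braid `T_k = δ₃^{3k+1} σ₄^{2k+2} σ₃ σ₄^{2k-1}`. -/
def T (k : ℕ) : B5 := δ3 ^ (3*k+1) * s4 ^ (2*k+2) * s3 * s4 ^ (2*k-1)

/-- The braid `T'_k`, a rigid conjugate of `T_k`. -/
def T' (k : ℕ) : B5 :=
  (s1*s3)^(2*k-2) * (s3*s4*Δ3) * (Δ3*s4) * ((δ3*s4)*(δt3*s4))^(k-1) * (δ3*s4*s3*s4)

open Matrix

/-- The Krammer matrices of the Artin generators, specialised at `q = -1`, `t = 3`, in the basis
`x₁₂, x₁₃, x₁₄, x₁₅, x₂₃, x₂₄, x₂₅, x₃₄, x₃₅, x₄₅`. -/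
def krammerGen : Fin 4 → Matrix (Fin 10) (Fin 10) ℤ :=
  ![!![3, 6, 6, 6, 0, 0, 0, 0, 0, 0; 0, 0, 0, 0, 1, 0, 0, 0, 0, 0;
       0, 0, 0, 0, 0, 1, 0, 0, 0, 0; 0, 0, 0, 0, 0, 0, 1, 0, 0, 0;
       0, -1, 0, 0, 2, 0, 0, 0, 0, 0; 0, 0, -1, 0, 0, 2, 0, 0, 0, 0;
       0, 0, 0, -1, 0, 0, 2, 0, 0, 0; 0, 0, 0, 0, 0, 0, 0, 1, 0, 0;
       0, 0, 0, 0, 0, 0, 0, 0, 1, 0; 0, 0, 0, 0, 0, 0, 0, 0, 0, 1],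
    !![2, 1, 0, 0, 0, 0, 0, 0, 0, 0; -1, 0, 0, 0, 0, 0, 0, 0, 0, 0;
       0, 0, 1, 0, 0, 0, 0, 0, 0, 0; 0, 0, 0, 1, 0, 0, 0, 0, 0, 0;
       0, -6, -12, -12, 3, 6, 6, 0, 0, 0; 0, 0, 0, 0, 0, 0, 0, 1, 0, 0;
       0, 0, 0, 0, 0, 0, 0, 0, 1, 0; 0, 0, 0, 0, 0, -1, 0, 2, 0, 0;
       0, 0, 0, 0, 0, 0, -1, 0, 2, 0; 0, 0, 0, 0, 0, 0, 0, 0, 0, 1],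
    !![1, 0, 0, 0, 0, 0, 0, 0, 0, 0; 0, 2, 1, 0, 0, 0, 0, 0, 0, 0;
       0, -1, 0, 0, 0, 0, 0, 0, 0, 0; 0, 0, 0, 1, 0, 0, 0, 0, 0, 0;
       0, 0, 0, 0, 2, 1, 0, 0, 0, 0; 0, 0, 0, 0, -1, 0, 0, 0, 0, 0;
       0, 0, 0, 0, 0, 0, 1, 0, 0, 0; 0, 0, 6, 12, 0, -6, -12, 3, 6, 0;
       0, 0, 0, 0, 0, 0, 0, 0, 0, 1; 0, 0, 0, 0, 0, 0, 0, 0, -1, 2],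
    !![1, 0, 0, 0, 0, 0, 0, 0, 0, 0; 0, 1, 0, 0, 0, 0, 0, 0, 0, 0;
       0, 0, 2, 1, 0, 0, 0, 0, 0, 0; 0, 0, -1, 0, 0, 0, 0, 0, 0, 0;
       0, 0, 0, 0, 1, 0, 0, 0, 0, 0; 0, 0, 0, 0, 0, 2, 1, 0, 0, 0;
       0, 0, 0, 0, 0, -1, 0, 0, 0, 0; 0, 0, 0, 0, 0, 0, 0, 2, 1, 0;
       0, 0, 0, 0, 0, 0, 0, -1, 0, 0; 0, 0, 0, -6, 0, 0, 6, 0, -6, 3]]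

theorem krammerGen_braid (i : Fin 3) :
    krammerGen i.castSucc * krammerGen i.succ * krammerGen i.castSucc =
      krammerGen i.succ * krammerGen i.castSucc * krammerGen i.succ := by
  revert i; decide +kernel

theorem krammerGen_comm (i j : Fin 4) (h : 2 ≤ |(i : ℤ) - (j : ℤ)|) :
    krammerGen i * krammerGen j = krammerGen j * krammerGen i := by
  revert i j; decide +kernel

theorem krammerGen_inv (i : Fin 4) :
    krammerGen i * (krammerGen i * krammerGen i - 5 • krammerGen i + 7) = 3 := by
  revert i; decide +kernel

/-- The product of the Krammer matrices along a word. -/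
def krammerWord (w : List (Fin 4)) : Matrix (Fin 10) (Fin 10) ℤ := (w.map krammerGen).prod

/-- The word defining `Δ`. -/
def wordΔ : List (Fin 4) := [0, 1, 2, 3, 0, 1, 2, 0, 1, 0]

/-- Entrywise reduction modulo 3. -/
abbrev mod3 : Matrix (Fin 10) (Fin 10) ℤ →+* Matrix (Fin 10) (Fin 10) (ZMod 3) :=
  (Int.castRingHom (ZMod 3)).mapMatrix

theorem vecMul_mod3_word (v : Fin 10 → ZMod 3) (w : List (Fin 4)) :
    v ᵥ* mod3 (krammerWord w) = w.foldl (fun u i => u ᵥ* mod3 (krammerGen i)) v := by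
  induction w generalizing v with
  | nil => simp [krammerWord]
  | cons i w ih =>
    rw [List.foldl_cons, ← ih, vecMul_vecMul, ← map_mul]
    rfl

theorem mulVec_mod3_word (v : Fin 10 → ZMod 3) (w : List (Fin 4)) :
    mod3 (krammerWord w) *ᵥ v = w.foldr (fun i u => mod3 (krammerGen i) *ᵥ u) v := by
  induction w with
  | nil => simp [krammerWord]
  | cons i w ih =>
    rw [List.foldr_cons, ← ih, mulVec_mulVec, ← map_mul]
    rfl

theorem mod3_wordΔ : mod3 (krammerWord wordΔ) = 0 := by
  decide +kernel

theorem vecMul_pow_of_eigen {n R : Type*} [Fintype n] [DecidableEq n] [CommRing R]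
    {v : n → R} {M : Matrix n n R} {c : R} (h : v ᵥ* M = c • v) (m : ℕ) :
    v ᵥ* M ^ m = c ^ m • v := by
  induction m with
  | zero => simp
  | succ m ih => rw [pow_succ, ← vecMul_vecMul, ih, smul_vecMul, h, smul_smul, pow_succ]

theorem mulVec_pow_of_fixed {n R : Type*} [Fintype n] [DecidableEq n] [CommRing R]
    {v : n → R} {M : Matrix n n R} (h : M *ᵥ v = v) (m : ℕ) : M ^ m *ᵥ v = v := by
  induction m with
  | zero => simp
  | succ m ih => rw [pow_succ, ← mulVec_mulVec, h, ih]

/-- The image of an Artin generator under the specialised Krammer representation. -/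
def krammerUnit (i : Fin 4) : (Matrix (Fin 10) (Fin 10) ℚ)ˣ :=
  let f := (Int.castRingHom ℚ).mapMatrix (m := Fin 10)
  have h : f (krammerGen i) * (f (krammerGen i) * f (krammerGen i) - 5 • f (krammerGen i) + 7) =
      (3 : ℚ) • 1 := by
    have := congrArg f (krammerGen_inv i)
    simp only [map_mul, map_add, map_sub, map_nsmul, map_ofNat] at this
    rw [this]
    ext a b
    simp [Matrix.ofNat_apply, Matrix.one_apply]
  { val := f (krammerGen i)
    inv := (3⁻¹ : ℚ) • (f (krammerGen i) * f (krammerGen i) - 5 • f (krammerGen i) + 7)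
    val_inv := by rw [mul_smul_comm, h, smul_smul]; norm_num
    inv_val := by
      refine mul_eq_one_comm.mp ?_
      rw [mul_smul_comm, h, smul_smul]; norm_num }

theorem krammerUnit_val (i : Fin 4) :
    (krammerUnit i : Matrix (Fin 10) (Fin 10) ℚ) =
      (Int.castRingHom ℚ).mapMatrix (krammerGen i) := rfl

theorem lift_krammerUnit_eq_one (r : FreeGroup (Fin 4)) (hr : r ∈ braidRels) :
    FreeGroup.lift krammerUnit r = 1 := by
  rcases hr with ⟨i, rfl⟩ | ⟨i, j, hij, rfl⟩
  · rw [map_mul, map_inv, mul_inv_eq_one]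
    simp only [map_mul, FreeGroup.lift_apply_of]
    apply Units.ext
    simp only [Units.val_mul, krammerUnit_val, ← map_mul, krammerGen_braid]
  · rw [map_mul, map_inv, mul_inv_eq_one]
    simp only [map_mul, FreeGroup.lift_apply_of]
    apply Units.ext
    simp only [Units.val_mul, krammerUnit_val, ← map_mul, krammerGen_comm i j hij]

/-- The Krammer representation of `B5` at `q = -1`, `t = 3`. -/
def krammer : B5 →* (Matrix (Fin 10) (Fin 10) ℚ)ˣ :=
  PresentedGroup.toGroup lift_krammerUnit_eq_one

/-- The braid `x` acts in the specialised Krammer representation by the integral matrix `N`. -/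
def ActsBy (x : B5) (N : Matrix (Fin 10) (Fin 10) ℤ) : Prop :=
  (krammer x : Matrix (Fin 10) (Fin 10) ℚ) = (Int.castRingHom ℚ).mapMatrix N

theorem ActsBy.unique {x : B5} {M N : Matrix (Fin 10) (Fin 10) ℤ} (hM : ActsBy x M)
    (hN : ActsBy x N) : M = N := by
  ext a b
  have := congrFun (congrFun (hM.symm.trans hN) a) b
  simpa using this

theorem actsBy_one : ActsBy 1 1 := by simp [ActsBy]

theorem ActsBy.mul {x y : B5} {M N : Matrix (Fin 10) (Fin 10) ℤ} (hx : ActsBy x M)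
    (hy : ActsBy y N) : ActsBy (x * y) (M * N) := by
  unfold ActsBy at *
  rw [map_mul, Units.val_mul, hx, hy, map_mul]

theorem ActsBy.pow {x : B5} {M : Matrix (Fin 10) (Fin 10) ℤ} (hx : ActsBy x M) (n : ℕ) :
    ActsBy (x ^ n) (M ^ n) := by
  unfold ActsBy at *
  rw [map_pow, Units.val_pow_eq_pow_val, hx, map_pow]

theorem actsBy_gen (i : Fin 4) : ActsBy (gen i) (krammerGen i) := by
  unfold ActsBy krammer gen
  rw [PresentedGroup.toGroup.of, krammerUnit_val]

theorem IsPos.exists_actsBy {x : B5} (hx : IsPos x) : ∃ N, ActsBy x N := by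
  induction hx using Submonoid.closure_induction with
  | mem x hx => obtain ⟨i, rfl⟩ := hx; exact ⟨_, actsBy_gen i⟩
  | one => exact ⟨1, actsBy_one⟩
  | mul x y _ _ hx hy =>
    obtain ⟨M, hM⟩ := hx
    obtain ⟨N, hN⟩ := hy
    exact ⟨M * N, hM.mul hN⟩

/-- The braid represented by a positive word. -/
def wordBraid (w : List (Fin 4)) : B5 := (w.map gen).prod

theorem wordBraid_append (u v : List (Fin 4)) :
    wordBraid (u ++ v) = wordBraid u * wordBraid v := by
  simp [wordBraid]

theorem isPos_wordBraid (w : List (Fin 4)) : IsPos (wordBraid w) := by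
  refine Submonoid.list_prod_mem _ fun x hx => ?_
  obtain ⟨i, -, rfl⟩ := List.mem_map.mp hx
  exact Submonoid.subset_closure ⟨i, rfl⟩

theorem actsBy_wordBraid (w : List (Fin 4)) : ActsBy (wordBraid w) (krammerWord w) := by
  induction w with
  | nil => exact actsBy_one
  | cons i w ih => exact (actsBy_gen i).mul ih

theorem wordBraid_wordΔ : wordBraid wordΔ = Δ := by
  simp [wordBraid, wordΔ, Δ, s1, s2, s3, s4, mul_assoc]

theorem mod3_eq_zero_of_Δ_mul {y : B5} (hy : IsPos y) {N : Matrix (Fin 10) (Fin 10) ℤ}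
    (hN : ActsBy (Δ * y) N) : mod3 N = 0 := by
  obtain ⟨M, hM⟩ := hy.exists_actsBy
  rw [hN.unique ((wordBraid_wordΔ ▸ actsBy_wordBraid wordΔ).mul hM), map_mul, mod3_wordΔ, zero_mul]

theorem mod3_eq_zero_of_mul_Δ {y : B5} (hy : IsPos y) {N : Matrix (Fin 10) (Fin 10) ℤ}
    (hN : ActsBy (y * Δ) N) : mod3 N = 0 := by
  obtain ⟨M, hM⟩ := hy.exists_actsBy
  rw [hN.unique (hM.mul (wordBraid_wordΔ ▸ actsBy_wordBraid wordΔ)), map_mul, mod3_wordΔ, mul_zero]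

theorem gen_comm {i j : Fin 4} (h : 2 ≤ |(i : ℤ) - (j : ℤ)|) : gen i * gen j = gen j * gen i := by
  refine mul_inv_eq_one.mp (PresentedGroup.one_of_mem (rels := braidRels) ?_)
  exact Or.inr ⟨i, j, h, rfl⟩

theorem gen_braid (i : Fin 3) :
    gen i.castSucc * gen i.succ * gen i.castSucc = gen i.succ * gen i.castSucc * gen i.succ := by
  refine mul_inv_eq_one.mp (PresentedGroup.one_of_mem (rels := braidRels) ?_)
  exact Or.inl ⟨i, rfl⟩

theorem gen_braid_of_abs_eq_one {i j : Fin 4} (h : |(i : ℤ) - (j : ℤ)| = 1) :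
    gen i * gen j * gen i = gen j * gen i * gen j := by
  have key : (∃ l : Fin 3, i = l.castSucc ∧ j = l.succ) ∨
      ∃ l : Fin 3, j = l.castSucc ∧ i = l.succ := by
    revert i j; decide
  obtain ⟨l, rfl, rfl⟩ | ⟨l, rfl, rfl⟩ := key
  · exact gen_braid l
  · exact (gen_braid l).symm

/-- Apply a braid relation to the subword starting at position `n`, if there is one. -/
def braidMove : List (Fin 4) → ℕ → List (Fin 4)
  | a :: w, n + 1 => a :: braidMove w n
  | a :: b :: w, 0 =>
    if 2 ≤ |(a : ℤ) - (b : ℤ)| then b :: a :: w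
    else match w with
      | c :: w' =>
        if a = c ∧ |(a : ℤ) - (b : ℤ)| = 1 then b :: a :: b :: w' else a :: b :: c :: w'
      | [] => [a, b]
  | w, _ => w

theorem wordBraid_braidMove (w : List (Fin 4)) (n : ℕ) :
    wordBraid (braidMove w n) = wordBraid w := by
  fun_induction braidMove w n with
  | case1 a w n ih => simpa [wordBraid] using ih
  | case2 a b w h => simp [wordBraid, ← mul_assoc, gen_comm h]
  | case3 a b c w' _ h =>
    obtain ⟨rfl, h⟩ := h
    simp [wordBraid, ← mul_assoc, gen_braid_of_abs_eq_one h]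
  | case4 => rfl
  | case5 => rfl
  | case6 => rfl

theorem wordBraid_eq_of_moves {u v : List (Fin 4)} (m : List ℕ) (h : m.foldl braidMove u = v) :
    wordBraid u = wordBraid v := by
  subst h
  induction m generalizing u with
  | nil => rfl
  | cons n m ih => rw [List.foldl_cons, ← ih, wordBraid_braidMove]

theorem gen_mul_Δ (i : Fin 4) : gen i * Δ = Δ * gen i.rev := by
  have h : ∀ i : Fin 4, wordBraid (i :: wordΔ) = wordBraid (wordΔ ++ [i.rev]) := by
    intro i
    fin_cases i
    · exact wordBraid_eq_of_moves [4, 5, 3, 1, 3, 5, 7, 8, 9, 4, 2, 3] (by decide)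
    · exact wordBraid_eq_of_moves [7, 5, 7, 9, 6, 0, 2, 3] (by decide)
    · exact wordBraid_eq_of_moves [8, 0, 1, 3, 4, 6] (by decide)
    · exact wordBraid_eq_of_moves [0, 1, 2, 4, 5, 7] (by decide)
  have := h i
  rw [wordBraid_append, wordBraid_wordΔ] at this
  simpa [wordBraid, ← wordBraid_wordΔ] using this

theorem wordBraid_mul_Δ (w : List (Fin 4)) :
    wordBraid w * Δ = Δ * wordBraid (w.map Fin.rev) := by
  induction w with
  | nil => simp [wordBraid]
  | cons i w ih =>
    change gen i * wordBraid w * Δ = Δ * (gen i.rev * wordBraid (w.map Fin.rev))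
    rw [mul_assoc, ih, ← mul_assoc, gen_mul_Δ, mul_assoc]

theorem commute_Δ_sq (x : B5) : Commute (Δ ^ 2) x := by
  have h : (⊤ : Subgroup B5) ≤ Subgroup.centralizer {Δ ^ 2} := by
    rw [← PresentedGroup.closure_range_of, Subgroup.closure_le]
    rintro _ ⟨i, rfl⟩
    rw [SetLike.mem_coe, Subgroup.mem_centralizer_singleton_iff]
    change gen i * Δ ^ 2 = Δ ^ 2 * gen i
    rw [pow_two, ← mul_assoc, gen_mul_Δ, mul_assoc, gen_mul_Δ, Fin.rev_rev, mul_assoc]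
  exact (Subgroup.mem_centralizer_singleton_iff.mp (h (Subgroup.mem_top x))).symm

theorem wordBraid_append_complement {s s' t t' : List (Fin 4)}
    (hs : wordBraid s * wordBraid s' = Δ) (ht : wordBraid t * wordBraid t' = Δ) :
    wordBraid (s ++ t) * wordBraid (t' ++ s'.map Fin.rev) = (Δ ^ 2) ^ 1 := by
  rw [wordBraid_append, wordBraid_append, mul_assoc, ← mul_assoc (wordBraid t), ht,
    ← wordBraid_mul_Δ, ← mul_assoc, hs, pow_one, pow_two]

theorem wordBraid_complement {s s' : List (Fin 4)} (m : List ℕ)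
    (h : m.foldl braidMove (s ++ s') = wordΔ) : wordBraid s * wordBraid s' = Δ := by
  rw [← wordBraid_append, wordBraid_eq_of_moves m h, wordBraid_wordΔ]

theorem mul_complement {a a' b b' : B5} {m n : ℕ} (ha : a * a' = (Δ ^ 2) ^ m)
    (hb : b * b' = (Δ ^ 2) ^ n) : (a * b) * (b' * a') = (Δ ^ 2) ^ (m + n) := by
  rw [mul_assoc, ← mul_assoc b, hb, ((commute_Δ_sq a').pow_left n).eq, ← mul_assoc, ha, pow_add]

theorem pow_complement {a a' : B5} (ha : a * a' = (Δ ^ 2) ^ 1) (n : ℕ) :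
    a ^ n * a' ^ n = (Δ ^ 2) ^ n := by
  induction n with
  | zero => simp
  | succ n ih => rw [pow_succ, pow_succ' a', mul_complement ih ha]

theorem IsPos.mul {x y : B5} (hx : IsPos x) (hy : IsPos y) : IsPos (x * y) :=
  Submonoid.mul_mem _ hx hy

theorem IsPos.pow {x : B5} (hx : IsPos x) (n : ℕ) : IsPos (x ^ n) :=
  Submonoid.pow_mem _ hx n

theorem isPos_Δ : IsPos Δ := wordBraid_wordΔ ▸ isPos_wordBraid wordΔ

theorem Pre.trans {x y z : B5} (hxy : Pre x y) (hyz : Pre y z) : Pre x z := by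
  have h := IsPos.mul hxy hyz
  rwa [mul_assoc, mul_inv_cancel_left] at h

theorem pre_Δ_zpow {p q : ℤ} (h : p ≤ q) : Pre (Δ ^ p) (Δ ^ q) := by
  obtain ⟨n, rfl⟩ := Int.le.dest h
  rw [Pre, _root_.zpow_add, inv_mul_cancel_left, zpow_natCast]
  exact isPos_Δ.pow n

theorem pre_of_mul_eq {x y z : B5} (hy : IsPos y) (h : x * y = z) : Pre x z := by
  rwa [Pre, ← h, inv_mul_cancel_left]

theorem canLen_le {x : B5} {n : ℕ} (hx : IsPos x) (h : Pre x (Δ ^ n)) : canLen x ≤ n :=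
  Nat.sInf_le ⟨0, n, by simp, by simp, by simpa [Pre] using hx, by simpa using h⟩

theorem canLen_eq_of_sharp {x : B5} {n : ℕ} (hn : 1 ≤ n) (hx : IsPos x) (hΔ : ¬ Pre Δ x)
    (h : Pre x (Δ ^ n)) (h' : ¬ Pre x (Δ ^ (n - 1))) : canLen x = n := by
  refine le_antisymm (canLen_le hx h) ?_
  refine le_csInf ⟨n, 0, n, by simp, by simp, by simpa [Pre] using hx, by simpa using h⟩ ?_
  rintro m ⟨p, q, -, hm, hp, hq⟩
  have hp0 : p ≤ 0 := by
    by_contra! hlt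
    have := (pre_Δ_zpow (p := 1) (q := p) (by omega)).trans hp
    rw [zpow_one] at this
    exact hΔ this
  have hqn : (n : ℤ) ≤ q := by
    by_contra! hlt
    have := hq.trans (pre_Δ_zpow (p := q) (q := (n - 1 : ℕ)) (by omega))
    rw [zpow_natCast] at this
    exact h' this
  omega

theorem conj_s1_T'_eq (n : ℕ) :
    s1⁻¹ * T' (n + 1) * s1 =
      (s1*s3)^(2*(n+1)-2) * (s3*s4*Δ3) * (δt3*s4) * ((δ3*s4)*(δt3*s4))^(n+1-1) *
        (δ3*s4*s3*s4) * s1 := by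
  have hc : Commute s1 ((s1 * s3) ^ (2*(n+1)-2)) := by
    refine ((Commute.refl s1).mul_right ?_).pow_right _
    exact gen_comm (i := 0) (j := 2) (by decide)
  have hw : s3*s4*Δ3*(Δ3*s4) = s1 * (s3*s4*Δ3*(δt3*s4)) := by
    have := wordBraid_eq_of_moves (u := [2, 3, 1, 0, 1, 1, 0, 1, 3])
      (v := [0, 2, 3, 1, 0, 1, 0, 1, 3]) [2, 1, 0] (by decide)
    simpa [wordBraid, s1, s2, s3, s4, Δ3, δt3, mul_assoc] using this
  simp only [T', mul_assoc] at hw ⊢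
  rw [inv_mul_eq_iff_eq_mul, ← mul_assoc s1, hc.eq]
  simp only [mul_assoc]
  congr 1
  simp only [← mul_assoc] at hw ⊢
  rw [hw]

theorem conj_s1_T'_eq_words (n : ℕ) :
    s1⁻¹ * T' (n + 1) * s1 = wordBraid [0, 2, 0, 2] ^ n * wordBraid ([2, 3, 1, 0, 1] ++ [0, 1, 3]) *
      (wordBraid ([1, 0, 3] ++ [0, 1, 3]) ^ n * wordBraid ([1, 0, 3, 2, 3] ++ [0])) := by
  rw [conj_s1_T'_eq, show 2 * (n + 1) - 2 = 2 * n by omega, pow_mul, Nat.add_sub_cancel]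
  simp [wordBraid, s1, s2, s3, s4, Δ3, δt3, δ3, pow_two, mul_assoc]

theorem complement_s1s3_sq :
    wordBraid [0, 2, 0, 2] * wordBraid [1, 2, 3, 0, 1, 2, 1, 0, 2, 1, 0, 3, 2, 1, 2, 3] =
      (Δ ^ 2) ^ 1 :=
  have h : wordBraid [0, 2] * wordBraid [1, 2, 3, 0, 1, 2, 1, 0] = Δ :=
    wordBraid_complement [1, 3, 4, 6] (by decide)
  wordBraid_append_complement h h

theorem complement_s3s4Δ3 : wordBraid [2, 3, 1, 0, 1] * wordBraid [2, 3, 1, 2, 0] = Δ :=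
  wordBraid_complement [1, 2, 3, 4, 6, 1, 3, 4, 0, 1, 3, 4, 6] (by decide)

theorem complement_δt3s4 : wordBraid [0, 1, 3] * wordBraid [2, 3, 0, 1, 2, 0, 1] = Δ :=
  wordBraid_complement [2, 4, 5, 7] (by decide)

theorem complement_δ3s4s3s4 : wordBraid [1, 0, 3, 2, 3] * wordBraid [1, 2, 3, 0, 1] = Δ :=
  wordBraid_complement [2, 4, 6, 7, 3, 4, 2, 4, 0, 2, 3] (by decide)

theorem complement_δ3s4δt3s4 :
    wordBraid ([1, 0, 3] ++ [0, 1, 3]) *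
      wordBraid [2, 3, 0, 1, 2, 0, 1, 2, 1, 0, 2, 1, 3, 2] = (Δ ^ 2) ^ 1 :=
  wordBraid_append_complement (s' := [1, 2, 3, 1, 2, 0, 1])
    (wordBraid_complement [2, 3, 5, 7, 0, 2, 3] (by decide)) complement_δt3s4

theorem complement_s3s4Δ3δt3s4 :
    wordBraid ([2, 3, 1, 0, 1] ++ [0, 1, 3]) *
      wordBraid [2, 3, 0, 1, 2, 0, 1, 1, 0, 2, 1, 3] = (Δ ^ 2) ^ 1 :=
  wordBraid_append_complement complement_s3s4Δ3 complement_δt3s4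

theorem complement_s3s4Δ3Δ3s4 :
    wordBraid ([2, 3, 1, 0, 1] ++ [1, 0, 1, 3]) *
      wordBraid [2, 3, 1, 2, 0, 1, 1, 0, 2, 1, 3] = (Δ ^ 2) ^ 1 :=
  wordBraid_append_complement complement_s3s4Δ3
    (wordBraid_complement (s' := [2, 3, 1, 2, 0, 1]) [3, 5, 7, 0, 2, 3] (by decide))

theorem complement_δ3s4s3s4s1 :
    wordBraid ([1, 0, 3, 2, 3] ++ [0]) *
      wordBraid [1, 2, 3, 0, 1, 2, 0, 1, 0, 2, 1, 0, 3, 2] = (Δ ^ 2) ^ 1 :=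
  wordBraid_append_complement complement_δ3s4s3s4
    (wordBraid_complement (s' := [1, 2, 3, 0, 1, 2, 0, 1, 0]) [] (by decide))

theorem conj_s1_T'_complement (n : ℕ) :
    (s1⁻¹ * T' (n + 1) * s1) *
      ((wordBraid [1, 2, 3, 0, 1, 2, 0, 1, 0, 2, 1, 0, 3, 2] *
          wordBraid [2, 3, 0, 1, 2, 0, 1, 2, 1, 0, 2, 1, 3, 2] ^ n) *
        (wordBraid [2, 3, 0, 1, 2, 0, 1, 1, 0, 2, 1, 3] *
          wordBraid [1, 2, 3, 0, 1, 2, 1, 0, 2, 1, 0, 3, 2, 1, 2, 3] ^ n)) =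
      Δ ^ (4 * (n + 1)) := by
  rw [conj_s1_T'_eq_words, mul_complement
    (mul_complement (pow_complement complement_s1s3_sq n) complement_s3s4Δ3δt3s4)
    (mul_complement (pow_complement complement_δ3s4δt3s4 n) complement_δ3s4s3s4s1), ← pow_mul]
  congr 1
  omega

theorem not_Δ_pre_conj_s1_T' (n : ℕ) : ¬ Pre Δ (s1⁻¹ * T' (n + 1) * s1) := by
  intro h
  have hx := conj_s1_T'_eq_words n
  rw [← mul_inv_cancel_left Δ (s1⁻¹ * T' (n + 1) * s1)] at hx
  have h0 := mod3_eq_zero_of_Δ_mul h (hx ▸ (((actsBy_wordBraid _).pow n).mul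
    (actsBy_wordBraid _)).mul (((actsBy_wordBraid _).pow n).mul (actsBy_wordBraid _)))
  have hA : ![0, 1, 1, 1, 2, 2, 2, 0, 0, 0] ᵥ* mod3 (krammerWord [0, 2, 0, 2]) =
      (1 : ZMod 3) • ![0, 1, 1, 1, 2, 2, 2, 0, 0, 0] := by
    rw [vecMul_mod3_word]; decide +kernel
  have hB : ![0, 1, 1, 1, 2, 2, 2, 0, 0, 0] ᵥ*
      mod3 (krammerWord ([2, 3, 1, 0, 1] ++ [0, 1, 3])) =
        (![0, 0, 2, 2, 0, 1, 1, 0, 0, 0] : Fin 10 → ZMod 3) := by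
    rw [vecMul_mod3_word]; decide +kernel
  have hP : ![0, 0, 2, 2, 0, 1, 1, 0, 0, 0] ᵥ*
      mod3 (krammerWord ([1, 0, 3] ++ [0, 1, 3])) =
        (-1 : ZMod 3) • ![0, 0, 2, 2, 0, 1, 1, 0, 0, 0] := by
    rw [vecMul_mod3_word]; decide +kernel
  have hC : ![0, 0, 2, 2, 0, 1, 1, 0, 0, 0] ᵥ*
      mod3 (krammerWord ([1, 0, 3, 2, 3] ++ [0])) ≠ (0 : Fin 10 → ZMod 3) := by
    rw [vecMul_mod3_word]; decide +kernel
  have h1 := congrArg (fun M => ![0, 1, 1, 1, 2, 2, 2, 0, 0, 0] ᵥ* M) h0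
  simp only [map_mul, map_pow, ← vecMul_vecMul, vecMul_pow_of_eigen hA, one_pow, one_smul, hB,
    vecMul_pow_of_eigen hP, smul_vecMul, vecMul_zero] at h1
  exact (smul_ne_zero (pow_ne_zero n (by decide)) hC) h1

theorem not_conj_s1_T'_pre (n : ℕ) :
    ¬ Pre (s1⁻¹ * T' (n + 1) * s1) (Δ ^ (4 * (n + 1) - 1)) := by
  intro h
  have hz := conj_s1_T'_complement n
  rw [← eq_inv_mul_iff_mul_eq, show 4 * (n + 1) = 4 * (n + 1) - 1 + 1 by omega, pow_succ,
    ← mul_assoc _ _ Δ] at hz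
  have h0 := mod3_eq_zero_of_mul_Δ h (hz ▸ ((actsBy_wordBraid _).mul
    ((actsBy_wordBraid _).pow n)).mul ((actsBy_wordBraid _).mul ((actsBy_wordBraid _).pow n)))
  have hA : mod3 (krammerWord [1, 2, 3, 0, 1, 2, 1, 0, 2, 1, 0, 3, 2, 1, 2, 3]) *ᵥ
      ![0, 0, 0, 0, 0, 0, 0, 1, 0, 0] = ![0, 0, 0, 0, 0, 0, 0, 1, 0, 0] := by
    rw [mulVec_mod3_word]; decide +kernel
  have hB : mod3 (krammerWord [2, 3, 0, 1, 2, 0, 1, 1, 0, 2, 1, 3]) *ᵥ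
      ![0, 0, 0, 0, 0, 0, 0, 1, 0, 0] = ![0, 2, 0, 0, 2, 0, 0, 0, 0, 2] := by
    rw [mulVec_mod3_word]; decide +kernel
  have hP : mod3 (krammerWord [2, 3, 0, 1, 2, 0, 1, 2, 1, 0, 2, 1, 3, 2]) *ᵥ
      ![0, 2, 0, 0, 2, 0, 0, 0, 0, 2] = ![0, 2, 0, 0, 2, 0, 0, 0, 0, 2] := by
    rw [mulVec_mod3_word]; decide +kernel
  have hC : mod3 (krammerWord [1, 2, 3, 0, 1, 2, 0, 1, 0, 2, 1, 0, 3, 2]) *ᵥ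
      ![0, 2, 0, 0, 2, 0, 0, 0, 0, 2] ≠ 0 := by
    rw [mulVec_mod3_word]; decide +kernel
  have h1 := congrArg (fun M => M *ᵥ ![0, 0, 0, 0, 0, 0, 0, 1, 0, 0]) h0
  simp only [map_mul, map_pow, ← mulVec_mulVec, mulVec_pow_of_fixed hA, hB,
    mulVec_pow_of_fixed hP, zero_mulVec] at h1
  exact hC h1

/-- Cycling the last simple factor of `T'_k` to the front exhibits a conjugate of canonical
length at most `4k - 1`. -/
theorem exists_isConj_T'_canLen_le (n : ℕ) :
    ∃ z, IsConj (T' (n + 1)) z ∧ canLen z ≤ 4 * (n + 1) - 1 := by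
  set y := wordBraid [0, 2, 0, 2] ^ n * wordBraid ([2, 3, 1, 0, 1] ++ [1, 0, 1, 3]) *
    wordBraid ([1, 0, 3] ++ [0, 1, 3]) ^ n with hy
  have hT : T' (n + 1) = y * wordBraid [1, 0, 3, 2, 3] := by
    rw [hy, T', show 2 * (n + 1) - 2 = 2 * n by omega, pow_mul, Nat.add_sub_cancel]
    simp [wordBraid, s1, s2, s3, s4, Δ3, δt3, δ3, pow_two, mul_assoc]
  have hcompl := mul_complement
    (mul_complement (pow_complement complement_s1s3_sq n) complement_s3s4Δ3Δ3s4)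
    (pow_complement complement_δ3s4δt3s4 n)
  rw [← hy] at hcompl
  have hpos : ∀ u v w : List (Fin 4),
      IsPos (wordBraid u ^ n * (wordBraid v * wordBraid w ^ n)) := fun u v w =>
    ((isPos_wordBraid u).pow n).mul ((isPos_wordBraid v).mul ((isPos_wordBraid w).pow n))
  refine ⟨wordBraid [1, 0, 3, 2, 3] * y, ?_, canLen_le ?_ ?_⟩
  · rw [hT, isConj_iff]
    exact ⟨wordBraid [1, 0, 3, 2, 3], by group⟩
  · rw [hy, mul_assoc]
    exact (isPos_wordBraid _).mul (hpos _ _ _)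
  · refine pre_of_mul_eq ((hpos
      [2, 3, 0, 1, 2, 0, 1, 2, 1, 0, 2, 1, 3, 2] [2, 3, 1, 2, 0, 1, 1, 0, 2, 1, 3]
      [1, 2, 3, 0, 1, 2, 1, 0, 2, 1, 0, 3, 2, 1, 2, 3]).mul
        (isPos_wordBraid [1, 2, 3, 0, 1])) ?_
    rw [mul_assoc (wordBraid _), ← mul_assoc y, hcompl, ((commute_Δ_sq _).pow_left _).eq, ← mul_assoc,
      complement_δ3s4s3s4, ← pow_mul, ← pow_succ']
    congr 1
    omega

/-- the conjugate `σ₁⁻¹ T'_k σ₁` equals the displayed product, is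
positive, has `¬(Δ ≼ x)`, `x ≼ Δ^{4k}` and `¬(x ≼ Δ^{4k-1})`; in particular its
canonical length is `4k` and it does not belong to the super summit set of `T'_k`. -/
theorem conj_s1_not_SSS (k : ℕ) (hk : 2 ≤ k) :
    s1⁻¹ * T' k * s1 =
      (s1*s3)^(2*k-2) * (s3*s4*Δ3) * (δt3*s4) * ((δ3*s4)*(δt3*s4))^(k-1) *
        (δ3*s4*s3*s4) * s1 ∧
    IsPos (s1⁻¹ * T' k * s1) ∧ ¬ Pre Δ (s1⁻¹ * T' k * s1) ∧
    Pre (s1⁻¹ * T' k * s1) (Δ ^ (4*k)) ∧ ¬ Pre (s1⁻¹ * T' k * s1) (Δ ^ (4*k-1)) ∧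
    canLen (s1⁻¹ * T' k * s1) = 4*k ∧
    ¬ InSSS (T' k) (s1⁻¹ * T' k * s1) := by
  obtain ⟨n, rfl⟩ : ∃ n, k = n + 1 := ⟨k - 1, by omega⟩
  have hpos : IsPos (s1⁻¹ * T' (n + 1) * s1) := by
    rw [conj_s1_T'_eq_words]
    exact (((isPos_wordBraid _).pow n).mul (isPos_wordBraid _)).mul
      (((isPos_wordBraid _).pow n).mul (isPos_wordBraid _))
  have hpre : Pre (s1⁻¹ * T' (n + 1) * s1) (Δ ^ (4 * (n + 1))) :=
    pre_of_mul_eq (((isPos_wordBraid _).mul ((isPos_wordBraid _).pow n)).mul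
      ((isPos_wordBraid _).mul ((isPos_wordBraid _).pow n))) (conj_s1_T'_complement n)
  have hlen := canLen_eq_of_sharp (by omega) hpos (not_Δ_pre_conj_s1_T' n) hpre
    (not_conj_s1_T'_pre n)
  refine ⟨conj_s1_T'_eq n, hpos, not_Δ_pre_conj_s1_T' n, hpre, not_conj_s1_T'_pre n, hlen, ?_⟩
  rintro ⟨-, hmin⟩
  obtain ⟨z, hz, hle⟩ := exists_isConj_T'_canLen_le n
  have := hmin z hz
  omega
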